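/- arXiv:1712.08699 — 2 statements merged into one kernel-verified Lean document; each statement's English description precedes it below -/
import Mathlib

section
/- Every finite graph G that contains no induced subgraph isomorphic to an odd cycle C_n with n ≥ 5, to C_5^+, to P_5^2, or to the bull graph B, is perfect; that is, χ(H) = ω(H) for every induced subgraph H of G. -/
/-- `C₅⁺`: the 5-cycle with one added chord, equivalently the complement of the path
`P₅` on 5 vertices. -/
def C5plus : SimpleGraph (Fin 5) := (SimpleGraph.pathGraph 5)ᶜ

/-- `P₅²`: the square (distance-2 power) of the path on 5 vertices: vertices `0,…,4`,
adjacent iff distinct and at distance at most 2 along the path. -/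
def P5sq : SimpleGraph (Fin 5) :=
  SimpleGraph.fromRel (fun i j : Fin 5 => i.val ≤ j.val + 2 ∧ j.val ≤ i.val + 2)

/-- The bull graph: a triangle `0,1,2` with pendant vertices `3` (adjacent to `0`) and
`4` (adjacent to `1`). -/
def bullGraph : SimpleGraph (Fin 5) :=
  SimpleGraph.fromRel (fun i j : Fin 5 =>
    (i = 0 ∧ j = 1) ∨ (i = 1 ∧ j = 2) ∨ (i = 0 ∧ j = 2) ∨ (i = 0 ∧ j = 3) ∨ (i = 1 ∧ j = 4))

/-- `G` contains an induced copy of one of the forbidden graphs: an odd cycle `Cₙ` with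
`n ≥ 5`, the graph `C₅⁺`, the graph `P₅²`, or the bull graph. -/
def HasObstruction {V : Type*} (G : SimpleGraph V) : Prop :=
  (∃ n : ℕ, 5 ≤ n ∧ Odd n ∧ Nonempty (SimpleGraph.cycleGraph n ↪g G)) ∨
    Nonempty (C5plus ↪g G) ∨ Nonempty (P5sq ↪g G) ∨ Nonempty (bullGraph ↪g G)

open SimpleGraph

theorem SimpleGraph.nonempty_embedding_of_adj_iff {V : Type*} {n : ℕ} {G : SimpleGraph V}
    (H : SimpleGraph (Fin n)) (hH : ∀ i j, (∀ k, H.Adj i k ↔ H.Adj j k) → i = j) (f : Fin n → V)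
    (hf : ∀ i j, i < j → (G.Adj (f i) (f j) ↔ H.Adj i j)) : Nonempty (H ↪g G) := by
  have hadj : ∀ i j, G.Adj (f i) (f j) ↔ H.Adj i j := by
    intro i j
    rcases lt_trichotomy i j with h | rfl | h
    · exact hf i j h
    · simp
    · rw [G.adj_comm, H.adj_comm]
      exact hf j i h
  refine ⟨⟨⟨f, fun i j hij => hH i j fun k => ?_⟩, @fun i j => hadj i j⟩⟩
  rw [← hadj, ← hadj, hij]

set_option synthInstance.maxSize 1000 in
theorem bullGraph_embedding {V : Type*} {G : SimpleGraph V} {a b c a' b' : V}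
    (hab : G.Adj a b) (hbc : G.Adj b c) (hac : G.Adj a c) (haa' : G.Adj a a') (hbb' : G.Adj b b')
    (hab' : ¬ G.Adj a b') (hba' : ¬ G.Adj b a') (hca' : ¬ G.Adj c a') (hcb' : ¬ G.Adj c b')
    (hab'' : ¬ G.Adj a' b') : HasObstruction G := by
  refine Or.inr (Or.inr (Or.inr (nonempty_embedding_of_adj_iff _ ?_ ![a, b, c, a', b'] ?_)))
  · unfold bullGraph; decide
  · intro i j hij
    fin_cases i <;> fin_cases j <;> simp_all [bullGraph]

theorem gem_embedding {V : Type*} {G : SimpleGraph V} {a b c d e : V}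
    (hab : G.Adj a b) (hbc : G.Adj b c) (hcd : G.Adj c d)
    (hea : G.Adj a e) (heb : G.Adj b e) (hec : G.Adj e c) (hed : G.Adj e d)
    (hac : ¬ G.Adj a c) (had : ¬ G.Adj a d) (hbd : ¬ G.Adj b d) : HasObstruction G := by
  refine Or.inr (Or.inr (Or.inl (nonempty_embedding_of_adj_iff _ ?_ ![a, b, e, c, d] ?_)))
  · unfold P5sq; decide
  · intro i j hij
    fin_cases i <;> fin_cases j <;> simp_all [P5sq]

theorem house_embedding {V : Type*} {G : SimpleGraph V} {r s t s' t' : V}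
    (hrs : G.Adj s r) (hrt : G.Adj r t) (hst : G.Adj s t) (hss' : G.Adj s s')
    (htt' : G.Adj t' t) (hst' : G.Adj t' s') (hrs' : ¬ G.Adj r s') (hrt' : ¬ G.Adj t' r)
    (hst'' : ¬ G.Adj s t') (hts' : ¬ G.Adj s' t) : HasObstruction G := by
  refine Or.inr (Or.inl (nonempty_embedding_of_adj_iff _ ?_ ![s, t', r, s', t] ?_))
  · simp only [C5plus, compl_adj, pathGraph_adj]; decide
  · intro i j hij
    fin_cases i <;> fin_cases j <;> simp_all [C5plus, pathGraph_adj]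

theorem odd_cycle_embedding {V : Type*} {G : SimpleGraph V} {n : ℕ} (hn : 5 ≤ n) (hodd : Odd n)
    (f : ℕ → V)
    (hf : ∀ i j, i < j → j < n → (G.Adj (f i) (f j) ↔ j = i + 1 ∨ (i = 0 ∧ j + 1 = n))) :
    HasObstruction G := by
  have key : ∀ i j : Fin n, (cycleGraph n).Adj i j ↔
      j.val = i.val + 1 ∨ i.val = j.val + 1 ∨ (i.val = 0 ∧ j.val + 1 = n) ∨
        (j.val = 0 ∧ i.val + 1 = n) := by
    intro i j
    rw [cycleGraph_adj']
    rcases lt_trichotomy i j with h | rfl | h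
    · rw [Fin.coe_sub_iff_lt.2 h, Fin.sub_val_of_le h.le]
      have : i.val < j.val := h
      omega
    · rw [Fin.sub_val_of_le le_rfl]
      omega
    · rw [Fin.coe_sub_iff_lt.2 h, Fin.sub_val_of_le h.le]
      have : j.val < i.val := h
      omega
  refine Or.inl ⟨n, hn, hodd, nonempty_embedding_of_adj_iff _ ?_ (fun i => f i) ?_⟩
  · intro i j h
    simp only [key] at h
    obtain ⟨k, hk⟩ : ∃ k : Fin n, k.val = if i.val + 1 = n then 0 else i.val + 1 :=
      ⟨⟨if i.val + 1 = n then 0 else i.val + 1, by split_ifs <;> omega⟩, rfl⟩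
    obtain ⟨l, hl⟩ : ∃ l : Fin n, l.val = if i.val = 0 then n - 1 else i.val - 1 :=
      ⟨⟨if i.val = 0 then n - 1 else i.val - 1, by split_ifs <;> omega⟩, rfl⟩
    have h1 := h k
    have h2 := h l
    ext
    split_ifs at hk hl <;> omega
  · intro i j hij
    rw [key, hf i j hij j.2]
    have : i.val < j.val := hij
    omega

/-- A function to `ℕ` behaving like the distance to a root: only one vertex has level `0`, levels
of adjacent vertices differ by at most one, and every other vertex has a neighbour one level
below. -/
structure IsLevelling {V : Type*} (G : SimpleGraph V) (ℓ : V → ℕ) : Prop where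
  eq_of_zero : ∀ u v, ℓ u = 0 → ℓ v = 0 → u = v
  le_of_adj : ∀ u v, G.Adj u v → ℓ u ≤ ℓ v + 1
  exists_parent : ∀ v, ℓ v ≠ 0 → ∃ p, G.Adj p v ∧ ℓ p + 1 = ℓ v

theorem isLevelling_dist {V : Type*} {G : SimpleGraph V} (hG : G.Connected) (r : V) :
    IsLevelling G (G.dist r) where
  eq_of_zero u v hu hv := by
    rw [hG.dist_eq_zero_iff] at hu hv
    exact hu.symm.trans hv
  le_of_adj u v h := by
    have := hG.dist_triangle (u := r) (v := v) (w := u)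
    rwa [dist_eq_one_iff_adj.2 h.symm] at this
  exists_parent v hv := by
    obtain ⟨w, hw⟩ := hG.exists_walk_length_eq_dist v r
    cases w with
    | nil => simp at hv
    | @cons _ p _ h w =>
      refine ⟨p, h.symm, ?_⟩
      have h1 := dist_le w
      have h2 := hG.dist_triangle (u := r) (v := p) (w := v)
      rw [dist_eq_one_iff_adj.2 h.symm] at h2
      rw [Walk.length_cons, dist_comm] at hw
      rw [dist_comm] at h1
      omega

namespace IsLevelling

variable {V : Type*} {G : SimpleGraph V} {ℓ : V → ℕ}

theorem not_adj (h : IsLevelling G ℓ) {u v : V} (huv : ℓ u + 1 < ℓ v ∨ ℓ v + 1 < ℓ u) :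
    ¬ G.Adj u v := fun hadj => by
  have := h.le_of_adj u v hadj
  have := h.le_of_adj v u hadj.symm
  omega

/-- Two descending paths `a` and `b` joined by the edge `a 0 - b 0` and by a common lower
neighbour of their endpoints form an odd induced cycle. -/
theorem hasObstruction_of_cycle (h : IsLevelling G ℓ) {a b : ℕ → V} {i k : ℕ} (hk : 1 ≤ k)
    (hki : k < i) (ha : ∀ j ≤ i, ℓ (a j) + j = i) (hb : ∀ j ≤ i, ℓ (b j) + j = i)
    (haa : ∀ j < i, G.Adj (a j) (a (j + 1))) (hbb : ∀ j < i, G.Adj (b j) (b (j + 1)))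
    (hab : ∀ j ≤ k, ∀ j' ≤ k, (G.Adj (a j) (b j') ↔ j = 0 ∧ j' = 0))
    (hclose : G.Adj (a (k + 1)) (b k)) : HasObstruction G := by
  refine odd_cycle_embedding (n := 2 * k + 3) (by omega) ⟨k + 1, by ring⟩
    (fun t => if t ≤ k + 1 then a (k + 1 - t) else b (t - (k + 2))) ?_
  intro s t hst ht
  have key : ∀ c : ℕ → V, (∀ j ≤ i, ℓ (c j) + j = i) → (∀ j < i, G.Adj (c j) (c (j + 1))) →
      ∀ p q, p < q → q ≤ i → (G.Adj (c p) (c q) ↔ q = p + 1) := by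
    intro c hc hcc p q hpq hq
    constructor
    · intro hadj
      by_contra hne
      refine h.not_adj ?_ hadj
      have := hc p (by omega)
      have := hc q (by omega)
      omega
    · rintro rfl
      exact hcc p (by omega)
  split_ifs with h1 h2 h2
  · rw [G.adj_comm, key a ha haa _ _ (by omega) (by omega)]
    omega
  · rcases Nat.eq_zero_or_pos s with rfl | hs
    · by_cases htk : t - (k + 2) = k
      · rw [htk]
        exact iff_of_true hclose (by omega)
      · refine iff_of_false (h.not_adj ?_) (by omega)
        have := ha (k + 1) (by omega)
        have := hb (t - (k + 2)) (by omega)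
        simp only [Nat.sub_zero]
        omega
    · rw [hab _ (by omega) _ (by omega)]
      omega
  · omega
  · rw [key b hb hbb _ _ (by omega) (by omega)]
    omega

theorem adj_of_adj_of_level_eq (h : IsLevelling G ℓ) (hobs : ¬ HasObstruction G) {x y u : V}
    (hxy : G.Adj x y) (hl : ℓ x = ℓ y) (hux : G.Adj u x) (hu : ℓ u + 1 = ℓ x) : G.Adj u y := by
  induction hn : ℓ x using Nat.strong_induction_on generalizing x y u with
  | _ i ih =>
  by_contra huy
  have common : ∀ p q, G.Adj p q → ℓ p = ℓ q → ℓ p < i →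
      ∃ c, G.Adj c p ∧ G.Adj c q ∧ ℓ c + 1 = ℓ p := by
    intro p q hpq hlpq hlp
    obtain ⟨c, hc, hlc⟩ := h.exists_parent p fun h0 =>
      hpq.ne (h.eq_of_zero _ _ h0 (hlpq ▸ h0))
    exact ⟨c, hc, ih _ hlp hpq hlpq hc hlc rfl, hlc⟩
  obtain ⟨par, hpar⟩ : ∃ par : V → V, ∀ v, ℓ v ≠ 0 → G.Adj (par v) v ∧ ℓ (par v) + 1 = ℓ v := by
    choose! par hpar using h.exists_parent
    exact ⟨par, hpar⟩
  have down : ∀ v j, j ≤ ℓ v → ℓ (par^[j] v) + j = ℓ v := by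
    intro v j
    induction j with
    | zero => simp
    | succ j ihj =>
      intro hj
      have h1 := ihj (by omega)
      have h2 := (hpar (par^[j] v) (by omega)).2
      rw [Function.iterate_succ_apply']
      omega
  have down_adj : ∀ v j, j < ℓ v → G.Adj (par^[j] v) (par^[j + 1] v) := by
    intro v j hj
    rw [Function.iterate_succ_apply']
    have := down v j hj.le
    exact (hpar _ (by omega)).1.symm
  obtain ⟨hwy, hlw⟩ := hpar y (by omega)
  have hwx : ¬ G.Adj (par y) x := by
    intro hwx
    have hne : ℓ u ≠ 0 := fun h0 => huy (h.eq_of_zero u (par y) h0 (by omega) ▸ hwy)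
    by_cases hwu : G.Adj (par y) u
    · obtain ⟨p, hpw, hpu, hlp⟩ := common _ _ hwu (by omega) (by omega)
      exact hobs (gem_embedding hpu hux hxy hpw hwu.symm hwx hwy
        (h.not_adj (by omega)) (h.not_adj (by omega)) huy)
    · obtain ⟨p, hpw, hlp⟩ := h.exists_parent (par y) (by omega)
      by_cases hpu : G.Adj p u
      · exact hobs (house_embedding (r := y) (s := x) (t := par y) (s' := u) (t' := p) hxy hwy.symm
          hwx.symm hux.symm hpw hpu (fun h' => huy h'.symm) (h.not_adj (by omega))
          (h.not_adj (by omega)) (fun h' => hwu h'.symm))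
      · exact hobs (bullGraph_embedding hwx.symm hwy hxy hux.symm hpw.symm (h.not_adj (by omega))
          hwu (fun h' => huy h'.symm) (h.not_adj (by omega)) (fun h' => hpu h'.symm))
  obtain ⟨a, ha0, ha1, ha, haa⟩ : ∃ a : ℕ → V, a 0 = x ∧ a 1 = u ∧ (∀ j ≤ i, ℓ (a j) + j = i) ∧
      ∀ j < i, G.Adj (a j) (a (j + 1)) := by
    refine ⟨fun j => if j = 0 then x else par^[j - 1] u, rfl, rfl, fun j hj => ?_, fun j hj => ?_⟩
    · rcases j with _ | j
      · simpa using hn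
      · have := down u j (by omega)
        simp only [Nat.add_eq_zero_iff, one_ne_zero, and_false, if_false, Nat.add_sub_cancel]
        omega
    · rcases j with _ | j
      · simpa using hux.symm
      · simpa using down_adj u j (by omega)
  obtain ⟨b, hb0, hb1, hb, hbb⟩ : ∃ b : ℕ → V, b 0 = y ∧ b 1 = par y ∧
      (∀ j ≤ i, ℓ (b j) + j = i) ∧ ∀ j < i, G.Adj (b j) (b (j + 1)) := by
    refine ⟨fun j => par^[j] y, rfl, rfl, fun j hj => ?_, fun j hj => down_adj y j (by omega)⟩
    have := down y j (by omega)
    dsimp only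
    omega
  have hi : 1 ≤ i := by omega
  have extend : ∀ k < i, (∀ j ≤ k, ∀ j' ≤ k, (G.Adj (a j) (b j') ↔ j = 0 ∧ j' = 0)) →
      ¬ G.Adj (a k) (b (k + 1)) → ¬ G.Adj (a (k + 1)) (b k) →
      ¬ G.Adj (a (k + 1)) (b (k + 1)) := by
    intro k hk hab h1 h2 hadj
    have hla := ha (k + 1) (by omega)
    have hlb := hb (k + 1) (by omega)
    have hla' := ha k (by omega)
    have hlb' := hb k (by omega)
    obtain ⟨c, hca, hcb, hlc⟩ := common _ _ hadj (by omega) (by omega)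
    by_cases hk0 : k = 0
    · subst hk0
      exact hobs (house_embedding (r := c) hca.symm hcb hadj (haa 0 hk).symm (hbb 0 hk)
        ((hab 0 le_rfl 0 le_rfl).2 ⟨rfl, rfl⟩).symm (h.not_adj (by omega)) (h.not_adj (by omega))
        h2 h1)
    · exact hobs (bullGraph_embedding hadj hcb.symm hca.symm (haa k hk).symm (hbb k hk).symm h2
        (fun h' => h1 h'.symm) (h.not_adj (by omega)) (h.not_adj (by omega))
        (fun h' => hk0 ((hab k le_rfl k le_rfl).1 h').1))
  have step : ∀ k < i, (∀ j ≤ k, ∀ j' ≤ k, (G.Adj (a j) (b j') ↔ j = 0 ∧ j' = 0)) →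
      ∀ j ≤ k + 1, ∀ j' ≤ k + 1, (G.Adj (a j) (b j') ↔ j = 0 ∧ j' = 0) := by
    intro k hk hab
    have h1 : ¬ G.Adj (a k) (b (k + 1)) := by
      intro hadj
      by_cases hk0 : k = 0
      · subst hk0
        rw [ha0, zero_add, hb1] at hadj
        exact hwx hadj.symm
      · refine hobs (h.hasObstruction_of_cycle (by omega) hk hb ha hbb haa (fun j hj j' hj' => ?_)
          hadj.symm)
        rw [G.adj_comm, hab j' hj' j hj, and_comm]
    have h2 : ¬ G.Adj (a (k + 1)) (b k) := by
      intro hadj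
      by_cases hk0 : k = 0
      · subst hk0
        rw [hb0, zero_add, ha1] at hadj
        exact huy hadj
      · exact hobs (h.hasObstruction_of_cycle (by omega) hk ha hb haa hbb hab hadj)
    have h3 := extend k hk hab h1 h2
    intro j hj j' hj'
    by_cases hle : j ≤ k ∧ j' ≤ k
    · exact hab j hle.1 j' hle.2
    refine iff_of_false ?_ (by omega)
    have hla := ha j (by omega)
    have hlb := hb j' (by omega)
    by_cases hfar : j + 1 < j' ∨ j' + 1 < j
    · exact h.not_adj (by omega)
    obtain ⟨rfl, rfl⟩ | ⟨rfl, rfl⟩ | ⟨rfl, rfl⟩ : (j = k ∧ j' = k + 1) ∨ (j = k + 1 ∧ j' = k) ∨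
      (j = k + 1 ∧ j' = k + 1) := by omega
    exacts [h1, h2, h3]
  have all : ∀ k ≤ i, ∀ j ≤ k, ∀ j' ≤ k, (G.Adj (a j) (b j') ↔ j = 0 ∧ j' = 0) := by
    intro k
    induction k with
    | zero =>
      intro _ j hj j' hj'
      obtain rfl : j = 0 := by omega
      obtain rfl : j' = 0 := by omega
      rw [ha0, hb0]
      exact iff_of_true hxy ⟨rfl, rfl⟩
    | succ k ihk => exact fun hk => step k (by omega) (ihk (by omega))
  have hroot : a i = b i := by
    have := ha i le_rfl
    have := hb i le_rfl
    exact h.eq_of_zero _ _ (by omega) (by omega)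
  have hlast := haa (i - 1) (by omega)
  rw [Nat.sub_add_cancel hi, hroot, all i le_rfl _ (by omega) _ le_rfl] at hlast
  omega

theorem exists_common_parent (h : IsLevelling G ℓ) (hobs : ¬ HasObstruction G) {x y : V}
    (hxy : G.Adj x y) (hl : ℓ x = ℓ y) : ∃ q, G.Adj q x ∧ G.Adj q y ∧ ℓ q + 1 = ℓ x := by
  obtain ⟨q, hq, hlq⟩ := h.exists_parent x fun h0 =>
    hxy.ne (h.eq_of_zero _ _ h0 (hl ▸ h0))
  exact ⟨q, hq, h.adj_of_adj_of_level_eq hobs hxy hl hq hlq, hlq⟩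

/-- No level contains an induced path on four vertices. -/
theorem not_path_four (h : IsLevelling G ℓ) (hobs : ¬ HasObstruction G) {a b c d : V}
    (hab : G.Adj a b) (hbc : G.Adj b c) (hcd : G.Adj c d) (hlab : ℓ a = ℓ b) (hlbc : ℓ b = ℓ c)
    (hlcd : ℓ c = ℓ d) (hac : ¬ G.Adj a c) (had : ¬ G.Adj a d) (hbd : ¬ G.Adj b d) : False := by
  obtain ⟨q, hqb, hqc, hlq⟩ := h.exists_common_parent hobs hbc hlbc
  have hqa := h.adj_of_adj_of_level_eq hobs hab.symm hlab.symm hqb hlq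
  have hqd := h.adj_of_adj_of_level_eq hobs hcd hlcd hqc (hlbc ▸ hlq)
  exact hobs (gem_embedding hab hbc hcd hqa.symm hqb.symm hqc hqd hac had hbd)

/-- Neighbourhoods in the next level of adjacent vertices of a level are nested. -/
theorem upper_neighbors_nested (h : IsLevelling G ℓ) (hobs : ¬ HasObstruction G) {u w x y : V}
    (huw : G.Adj u w) (hl : ℓ u = ℓ w) (hux : G.Adj u x) (hlx : ℓ x = ℓ u + 1) (hwx : ¬ G.Adj w x)
    (hwy : G.Adj w y) (hly : ℓ y = ℓ w + 1) : G.Adj u y := by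
  by_contra huy
  obtain ⟨q, hqu, hqw, hlq⟩ := h.exists_common_parent hobs huw hl
  refine hobs (bullGraph_embedding huw hqw.symm hqu.symm hux hwy huy hwx (h.not_adj (by omega))
    (h.not_adj (by omega)) fun hxy => ?_)
  exact huy (h.adj_of_adj_of_level_eq hobs hxy (by omega) hux (by omega))

end IsLevelling

/-- Greedy colouring along an order in which `m` is weakly increasing. -/
theorem SimpleGraph.exists_greedy_coloring {V : Type*} [Fintype V] (H : SimpleGraph V)
    (m : V → ℕ) : ∃ c : V → ℕ, (∀ u v, H.Adj u v → c u ≠ c v) ∧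
      ∀ u, ∀ j < c u, ∃ z, H.Adj z u ∧ c z = j ∧ m z ≤ m u := by
  classical
  suffices hs : ∀ s : Finset V, ∃ c : V → ℕ, (∀ u ∈ s, ∀ v ∈ s, H.Adj u v → c u ≠ c v) ∧
      ∀ u ∈ s, ∀ j < c u, ∃ z ∈ s, H.Adj z u ∧ c z = j ∧ m z ≤ m u by
    obtain ⟨c, h1, h2⟩ := hs Finset.univ
    exact ⟨c, fun u v => h1 u (Finset.mem_univ u) v (Finset.mem_univ v),
      fun u j hj => by simpa using h2 u (Finset.mem_univ u) j hj⟩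
  intro s
  induction s using Finset.induction_on_max_value m with
  | empty => exact ⟨fun _ => 0, by simp⟩
  | insert a s ha hmax ih =>
    obtain ⟨c, hc, hg⟩ := ih
    have hex : ∃ k, ∀ z ∈ s, H.Adj z a → c z ≠ k := by
      obtain ⟨k, hk⟩ := Infinite.exists_notMem_finset (s.image c)
      exact ⟨k, fun z hz _ hzk => hk (Finset.mem_image.2 ⟨z, hz, hzk⟩)⟩
    have hne : ∀ z ∈ s, z ≠ a := fun z hz hza => ha (hza ▸ hz)
    refine ⟨Function.update c a (Nat.find hex), ?_, ?_⟩
    · intro u hu v hv huv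
      rw [Finset.mem_insert] at hu hv
      rcases hu with rfl | hu <;> rcases hv with rfl | hv
      · exact absurd huv (H.irrefl)
      · rw [Function.update_self, Function.update_of_ne (hne v hv)]
        exact (Nat.find_spec hex v hv huv.symm).symm
      · rw [Function.update_self, Function.update_of_ne (hne u hu)]
        exact Nat.find_spec hex u hu huv
      · rw [Function.update_of_ne (hne u hu), Function.update_of_ne (hne v hv)]
        exact hc u hu v hv huv
    · intro u hu j hj
      rcases Finset.mem_insert.1 hu with rfl | hu
      · rw [Function.update_self] at hj
        have := Nat.find_min hex hj
        push Not at this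
        obtain ⟨z, hz, hza, hzj⟩ := this
        refine ⟨z, Finset.mem_insert_of_mem hz, hza, ?_, hmax z hz⟩
        rwa [Function.update_of_ne (hne z hz)]
      · rw [Function.update_of_ne (hne u hu)] at hj
        obtain ⟨z, hz, hzu, hzj, hm⟩ := hg u hu j hj
        refine ⟨z, Finset.mem_insert_of_mem hz, hzu, ?_, hm⟩
        rwa [Function.update_of_ne (hne z hz)]

/-- In a graph without induced `P₄`, a greedy colouring relative to `P` gives every vertex `u` of
`P` a colour `c u` witnessed by a clique of `P` of size `c u + 1`. -/
theorem SimpleGraph.exists_isClique_of_greedy {V : Type*} [Fintype V] {H : SimpleGraph V}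
    (hP4 : ∀ a b c d, H.Adj a b → H.Adj b c → H.Adj c d → ¬ H.Adj a c → ¬ H.Adj a d →
      ¬ H.Adj b d → False) {c : V → ℕ} (hc : ∀ u v, H.Adj u v → c u ≠ c v) {P : Set V}
    (hg : ∀ u ∈ P, ∀ j < c u, ∃ z ∈ P, H.Adj z u ∧ c z = j) {u : V} (hu : u ∈ P) :
    ∃ Q : Finset V, H.IsClique Q ∧ u ∈ Q ∧ (∀ q ∈ Q, q ∈ P) ∧ Q.card = c u + 1 := by
  classical
  suffices hs : ∀ k ≤ c u, ∃ Q : Finset V, H.IsClique Q ∧ u ∈ Q ∧ (∀ q ∈ Q, q ∈ P) ∧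
      Q.card = k + 1 ∧ ∀ q ∈ Q, c u ≤ c q + k by
    obtain ⟨Q, h1, h2, h3, h4, -⟩ := hs (c u) le_rfl
    exact ⟨Q, h1, h2, h3, h4⟩
  intro k
  induction k with
  | zero => exact fun _ => ⟨{u}, by simp, by simp, by simpa using hu, by simp, by simp⟩
  | succ k ih =>
    intro hk
    obtain ⟨Q, hQ, huQ, hQP, hcard, hcol⟩ := ih (by omega)
    obtain ⟨j, hj⟩ : ∃ j, j + (k + 1) = c u := ⟨c u - (k + 1), by omega⟩
    have hlt : ∀ q ∈ Q, j < c q := fun q hq => by have := hcol q hq; omega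
    obtain ⟨z₀, hz₀P, -, hz₀j⟩ := hg u hu j (by omega)
    obtain ⟨z, hz, hmax⟩ := Finset.exists_max_image
      (Finset.univ.filter fun z => z ∈ P ∧ c z = j) (fun z => (Q.filter fun q => H.Adj z q).card)
      ⟨z₀, by simp [hz₀P, hz₀j]⟩
    simp only [Finset.mem_filter, Finset.mem_univ, true_and] at hz hmax
    have hall : ∀ q ∈ Q, H.Adj z q := by
      intro q hq
      by_contra hzq
      obtain ⟨z', hz'P, hz'q, hz'j⟩ := hg q (hQP q hq) j (hlt q hq)
      obtain ⟨q', hq', hzq', hz'q'⟩ : ∃ q' ∈ Q, H.Adj z q' ∧ ¬ H.Adj z' q' := by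
        by_contra! hno
        refine absurd (hmax z' ⟨hz'P, hz'j⟩) (not_le.2 (Finset.card_lt_card ?_))
        refine Finset.ssubset_iff_of_subset (fun r hr => ?_) |>.2 ⟨q, ?_, ?_⟩
        · rw [Finset.mem_filter] at hr ⊢
          exact ⟨hr.1, hno r hr.1 hr.2⟩
        · exact Finset.mem_filter.2 ⟨hq, hz'q⟩
        · simp [hzq]
      have hqq' : q' ≠ q := by rintro rfl; exact hzq hzq'
      exact hP4 z q' q z' hzq' (hQ hq' hq hqq') hz'q.symm hzq
        (fun h => hc _ _ h (hz.2.trans hz'j.symm)) fun h => hz'q' h.symm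
    have hzQ : z ∉ Q := fun h => H.irrefl (hall z h)
    refine ⟨insert z Q, ?_, Finset.mem_insert_of_mem huQ, ?_, ?_, ?_⟩
    · rw [Finset.coe_insert]
      exact hQ.insert fun q hq _ => hall q hq
    · intro q hq
      rcases Finset.mem_insert.1 hq with rfl | hq
      exacts [hz.1, hQP q hq]
    · rw [Finset.card_insert_of_notMem hzQ, hcard]
    · intro q hq
      rcases Finset.mem_insert.1 hq with rfl | hq
      · omega
      · have := hcol q hq
        omega

theorem IsLevelling.colorable_cliqueNum {V : Type*} [Fintype V] {G : SimpleGraph V} {ℓ : V → ℕ}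
    (h : IsLevelling G ℓ) (hobs : ¬ HasObstruction G) : G.Colorable G.cliqueNum := by
  classical
  let H : SimpleGraph V :=
    { Adj := fun u v => G.Adj u v ∧ ℓ u = ℓ v
      symm := ⟨fun _ _ huv => ⟨huv.1.symm, huv.2.symm⟩⟩
      loopless := ⟨fun _ huv => G.irrefl huv.1⟩ }
  let up : V → Finset V := fun u => Finset.univ.filter fun x => G.Adj u x ∧ ℓ x = ℓ u + 1
  have hP4 : ∀ a b c d, H.Adj a b → H.Adj b c → H.Adj c d → ¬ H.Adj a c → ¬ H.Adj a d →
      ¬ H.Adj b d → False := fun a b c d hab hbc hcd hac had hbd =>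
    h.not_path_four hobs hab.1 hbc.1 hcd.1 hab.2 hbc.2 hcd.2
      (fun h' => hac ⟨h', hab.2.trans hbc.2⟩)
      (fun h' => had ⟨h', (hab.2.trans hbc.2).trans hcd.2⟩)
      (fun h' => hbd ⟨h', hbc.2.trans hcd.2⟩)
  obtain ⟨c, hc, hg⟩ := H.exists_greedy_coloring fun u => Fintype.card V - (up u).card
  have hup : ∀ u z, H.Adj z u → Fintype.card V - (up z).card ≤ Fintype.card V - (up u).card →
      up u ⊆ up z := by
    intro u z hzu hm
    have hcu : (up u).card ≤ Fintype.card V := Finset.card_le_univ _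
    have hcz : (up z).card ≤ Fintype.card V := Finset.card_le_univ _
    by_contra hsub
    obtain ⟨x, hxu, hxz⟩ := Finset.not_subset.1 hsub
    simp only [up, Finset.mem_filter, Finset.mem_univ, true_and, not_and] at hxu hxz
    have hlt : (up z).card < (up u).card := by
      refine Finset.card_lt_card ((Finset.ssubset_iff_of_subset fun y hy => ?_).2 ⟨x, ?_, ?_⟩)
      · simp only [up, Finset.mem_filter, Finset.mem_univ, true_and] at hy ⊢
        have hlzu := hzu.2
        exact ⟨h.upper_neighbors_nested hobs hzu.1.symm hlzu.symm hxu.1 hxu.2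
          (fun h' => hxz h' (by omega)) hy.1 hy.2, by omega⟩
      · simpa [up] using hxu
      · simpa [up] using hxz
    omega
  have hclique : ∀ Q : Finset V, H.IsClique Q → G.IsClique Q :=
    fun Q hQ a ha b hb hab => (hQ ha hb hab).1
  have top : ∀ x, ∃ Q : Finset V, H.IsClique Q ∧ x ∈ Q ∧ Q.card = c x + 1 := by
    intro x
    obtain ⟨Q, h1, h2, -, h4⟩ := exists_isClique_of_greedy hP4 hc (P := Set.univ)
      (fun u _ j hj => by
        obtain ⟨z, hz, hzj, -⟩ := hg u j hj
        exact ⟨z, trivial, hz, hzj⟩) (Set.mem_univ x)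
    exact ⟨Q, h1, h2, h4⟩
  have hlt : ∀ x, c x < G.cliqueNum := by
    intro x
    obtain ⟨Q, h1, -, h3⟩ := top x
    have := IsClique.card_le_cliqueNum (tc := hclique Q h1)
    omega
  have hsum : ∀ u x, G.Adj u x → ℓ x = ℓ u + 1 → c u + c x + 2 ≤ G.cliqueNum := by
    intro u x hux hl
    obtain ⟨Q, hQ, hxQ, hQcard⟩ := top x
    obtain ⟨R, hR, -, hRP, hRcard⟩ := exists_isClique_of_greedy hP4 hc (P := {z | x ∈ up z})
      (fun v hv j hj => by
        obtain ⟨z, hz, hzj, hm⟩ := hg v j hj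
        exact ⟨z, hup v z hz hm hv, hz, hzj⟩) (show u ∈ {z | x ∈ up z} by simp [up, hux, hl])
    simp only [up, Set.mem_ofPred_eq, Finset.mem_filter, Finset.mem_univ, true_and] at hRP
    have hQl : ∀ q ∈ Q, ℓ q = ℓ x := by
      intro q hq
      by_cases hqx : q = x
      · rw [hqx]
      · exact (hQ hq hxQ hqx).2
    have hcomplete : ∀ q ∈ Q, ∀ r ∈ R, G.Adj r q := by
      intro q hq r hr
      by_cases hqx : q = x
      · exact hqx ▸ (hRP r hr).1
      · exact h.adj_of_adj_of_level_eq hobs (hQ hxQ hq (Ne.symm hqx)).1 (hQl q hq).symm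
          (hRP r hr).1 (hRP r hr).2.symm
    have hdisj : Disjoint Q R := Finset.disjoint_left.2 fun v hq hr =>
      G.irrefl (hcomplete v hq v hr)
    have hQR : G.IsClique (Q ∪ R : Finset V) := by
      intro a ha b hb hab
      rw [Finset.mem_coe, Finset.mem_union] at ha hb
      rcases ha with ha | ha <;> rcases hb with hb | hb
      · exact hclique Q hQ ha hb hab
      · exact (hcomplete a ha b hb).symm
      · exact hcomplete b hb a ha
      · exact hclique R hR ha hb hab
    have := IsClique.card_le_cliqueNum (tc := hQR)
    rw [Finset.card_union_of_disjoint hdisj] at this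
    omega
  rw [colorable_iff_exists_bdd_nat_coloring]
  refine ⟨Coloring.mk (fun v => if Even (ℓ v) then c v else G.cliqueNum - 1 - c v) ?_, ?_⟩
  · intro u v huv
    have hu := hlt u
    have hv := hlt v
    have h1 := h.le_of_adj u v huv
    have h2 := h.le_of_adj v u huv.symm
    obtain hl | hl | hl : ℓ u = ℓ v ∨ ℓ v = ℓ u + 1 ∨ ℓ u = ℓ v + 1 := by omega
    · have := hc u v ⟨huv, hl⟩
      rw [hl]
      split_ifs <;> omega
    · have := hsum u v huv hl
      simp only [hl, Nat.even_add_one]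
      split_ifs <;> omega
    · have := hsum v u huv.symm hl
      simp only [hl, Nat.even_add_one]
      split_ifs <;> omega
  · intro v
    have := hlt v
    change (if Even (ℓ v) then c v else G.cliqueNum - 1 - c v) < G.cliqueNum
    split_ifs <;> omega

theorem HasObstruction.of_embedding {V W : Type*} {G : SimpleGraph V} {H : SimpleGraph W}
    (e : H ↪g G) (h : HasObstruction H) : HasObstruction G := by
  rcases h with ⟨n, hn, hodd, ⟨f⟩⟩ | ⟨⟨f⟩⟩ | ⟨⟨f⟩⟩ | ⟨⟨f⟩⟩
  exacts [Or.inl ⟨n, hn, hodd, ⟨f.trans e⟩⟩, Or.inr (Or.inl ⟨f.trans e⟩),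
    Or.inr (Or.inr (Or.inl ⟨f.trans e⟩)), Or.inr (Or.inr (Or.inr ⟨f.trans e⟩))]

theorem colorable_cliqueNum_of_not_hasObstruction {V : Type*} [Fintype V] {G : SimpleGraph V}
    (hobs : ¬ HasObstruction G) : G.Colorable G.cliqueNum := by
  classical
  rw [colorable_iff_forall_connectedComponent]
  intro C
  obtain ⟨r⟩ := C.connected_toSimpleGraph.nonempty
  exact ((isLevelling_dist C.connected_toSimpleGraph r).colorable_cliqueNum fun h' =>
    hobs (h'.of_embedding (Embedding.induce _))).mono (cliqueNum_induce_le _)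

/-- Every finite graph `G` with no induced odd cycle `Cₙ` (`n ≥ 5`), no induced `C₅⁺`, no
induced `P₅²`, and no induced bull is perfect: every induced subgraph `H` of `G`
satisfies `χ(H) = ω(H)`. -/
theorem no_obstruction_perfect {V : Type} [Fintype V] (G : SimpleGraph V)
    (hobs : ¬ HasObstruction G) :
    ∀ s : Set V, (G.induce s).chromaticNumber = ((G.induce s).cliqueNum : ℕ∞) := by
  classical
  intro s
  exact le_antisymm (colorable_cliqueNum_of_not_hasObstruction fun h =>
    hobs (h.of_embedding (Embedding.induce s))).chromaticNumber_le cliqueNum_le_chromaticNumber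
end

section
/- Let G be a finite graph and let u_1, …, u_t be distinct vertices of G such that: (i) there exist vertices x and y with u_1 x y u_t a path in G and the subgraph of G induced by {u_1, x, y, u_t} bipartite; and (ii) for each 1 ≤ i < t there is a common neighbor z_i of u_i and u_{i+1} such that the subgraph of G induced by {u_1,…,u_t} ∪ {z_i} is bipartite. Then for every even positive integer w, f(w,G) ≥ (1 + 1/(2t))·w. -/
/-!  Common definitions: the online token-coloring game of Milans–Wigal. -/

/-- Tokens `i` and `j` of the play `s` (Spoiler's `i`-th move is at vertex `s i`) are
adjacent in the token graph: they are distinct tokens lying on the same vertex or on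
adjacent vertices of `G`. -/
def TokenAdj {V : Type*} (G : SimpleGraph V) (s : ℕ → V) (i j : ℕ) : Prop :=
  i ≠ j ∧ (s i = s j ∨ G.Adj (s i) (s j))

/-- The play consisting of the first `n` tokens of `s` is legal for Spoiler in the game of
width `w`: the token graph on these `n` tokens has chromatic number at most `w`. -/
def LegalPlay {V : Type*} (G : SimpleGraph V) (w : ℕ) (s : ℕ → V) (n : ℕ) : Prop :=
  ∃ φ : ℕ → ℕ, (∀ i, i < n → φ i < w) ∧
    ∀ i j, i < n → j < n → TokenAdj G s i j → φ i ≠ φ j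

/-- The color that Algorithm's (deterministic, online) strategy `σ` assigns to the `i`-th
token of the play `s`: `σ` is applied to the history of Spoiler's moves up to and
including the `i`-th one. -/
def colorOf {V : Type*} (σ : List V → ℕ) (s : ℕ → V) (i : ℕ) : ℕ :=
  σ (List.ofFn fun j : Fin (i + 1) => s j)

/-- Strategy `σ` for Algorithm wins the token game on `G` of width `w` using at most `k`
colors: against every legal Spoiler play, all assigned colors lie in `{0, …, k-1}` and the
resulting coloring of the token graph is proper. -/
def AlgWins {V : Type*} (G : SimpleGraph V) (w k : ℕ) (σ : List V → ℕ) : Prop :=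
  ∀ (n : ℕ) (s : ℕ → V), LegalPlay G w s n →
    (∀ i, i < n → colorOf σ s i < k) ∧
    ∀ i j, i < n → j < n → TokenAdj G s i j → colorOf σ s i ≠ colorOf σ s j

/-- `gameValue G w` is the value `f(w, G)` of the token game on `G` of width `w`: the
minimum number of colors with which Algorithm has a winning strategy. -/
noncomputable def gameValue {V : Type*} (G : SimpleGraph V) (w : ℕ) : ℕ :=
  sInf {k | ∃ σ : List V → ℕ, AlgWins G w k σ}

/-- The colors that the strategy `σ` assigns to the `b`-th block when Spoiler plays `h` tokens on
each of the vertices `f 0, f 1, …` in turn. -/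
def blockColors {V : Type*} (σ : List V → ℕ) (h : ℕ) (f : ℕ → V) (b : ℕ) : Finset ℕ :=
  (Finset.Ico (b * h) ((b + 1) * h)).image (colorOf σ fun n => f (n / h))

lemma colorOf_congr {V : Type*} (σ : List V → ℕ) {s s' : ℕ → V} {i : ℕ}
    (hs : ∀ j ≤ i, s j = s' j) : colorOf σ s i = colorOf σ s' i := by
  unfold colorOf
  congr 2
  funext j
  exact hs j (Nat.lt_succ_iff.mp j.2)

lemma blockColors_congr {V : Type*} (σ : List V → ℕ) (h : ℕ) {f f' : ℕ → V} {b : ℕ}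
    (hf : ∀ c ≤ b, f c = f' c) : blockColors σ h f b = blockColors σ h f' b := by
  unfold blockColors
  refine Finset.image_congr fun i hi => colorOf_congr σ fun j hj => hf _ ?_
  have hi' := (Finset.mem_Ico.mp (Finset.mem_coe.mp hi)).2
  exact Nat.lt_succ_iff.mp (Nat.div_lt_of_lt_mul (by rw [mul_comm]; exact hj.trans_lt hi'))

/-- Playing `h` tokens on each of `m` distinct vertices of a bipartite induced subgraph is legal
in the game of width `2 * h`. -/
lemma legalPlay_blocks {V : Type*} {G : SimpleGraph V} {h m : ℕ} (hh : 0 < h) {f : ℕ → V}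
    {S : Set V} (hS : (G.induce S).Colorable 2) (hfS : ∀ b < m, f b ∈ S)
    (hf : ∀ b < m, ∀ c < m, f b = f c → b = c) :
    LegalPlay G (2 * h) (fun n => f (n / h)) (m * h) := by
  classical
  obtain ⟨C⟩ := hS
  let c : V → ℕ := fun v => if hv : v ∈ S then (C ⟨v, hv⟩ : ℕ) else 0
  have hc : ∀ v, c v < 2 := by
    intro v
    dsimp only [c]
    split_ifs
    · exact Fin.is_lt _
    · norm_num
  refine ⟨fun i => c (f (i / h)) * h + i % h, fun i _ => ?_, fun i j hi hj hij he => ?_⟩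
  · have := Nat.mod_lt i hh
    have := hc (f (i / h))
    nlinarith
  · have hib : i / h < m := Nat.div_lt_of_lt_mul (by rwa [mul_comm])
    have hjb : j / h < m := Nat.div_lt_of_lt_mul (by rwa [mul_comm])
    have key : ∀ a i : ℕ, (a * h + i % h) / h = a ∧ (a * h + i % h) % h = i % h := by
      intro a i
      have := Nat.mod_lt i hh
      constructor
      · rw [mul_comm, Nat.mul_add_div hh, Nat.div_eq_of_lt this, add_zero]
      · rw [mul_comm, Nat.mul_add_mod, Nat.mod_mod]
    have e1 : c (f (i / h)) = c (f (j / h)) := by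
      rw [← (key (c (f (i / h))) i).1, ← (key (c (f (j / h))) j).1]
      exact congrArg (· / h) he
    have e2 : i % h = j % h := by
      rw [← (key (c (f (i / h))) i).2, ← (key (c (f (j / h))) j).2]
      exact congrArg (· % h) he
    obtain ⟨hne, hsame | hadj⟩ := hij
    · have hq := hf _ hib _ hjb hsame
      apply hne
      rw [← Nat.div_add_mod i h, ← Nat.div_add_mod j h, hq, e2]
    · have hvalid := C.valid (v := ⟨_, hfS _ hib⟩) (w := ⟨_, hfS _ hjb⟩) hadj
      simp only [c, hfS _ hib, hfS _ hjb, dif_pos] at e1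
      exact hvalid (Fin.ext e1)

lemma AlgWins.blockColors_spec {V : Type*} {G : SimpleGraph V} {h m k : ℕ} (hh : 0 < h)
    {σ : List V → ℕ} (hσ : AlgWins G (2 * h) k σ) {f : ℕ → V}
    {S : Set V} (hS : (G.induce S).Colorable 2) (hfS : ∀ b < m, f b ∈ S)
    (hf : ∀ b < m, ∀ c < m, f b = f c → b = c) :
    (∀ b < m, blockColors σ h f b ⊆ Finset.range k) ∧
    (∀ b < m, (blockColors σ h f b).card = h) ∧
    ∀ b < m, ∀ c < m, G.Adj (f b) (f c) →
      Disjoint (blockColors σ h f b) (blockColors σ h f c) := by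
  obtain ⟨hk, hp⟩ := hσ _ _ (legalPlay_blocks hh hS hfS hf)
  have hdiv : ∀ b i, i ∈ Finset.Ico (b * h) ((b + 1) * h) → i / h = b := fun b i hi => by
    rw [Finset.mem_Ico] at hi
    exact Nat.div_eq_of_lt_le hi.1 hi.2
  have hlt : ∀ b < m, ∀ i, i ∈ Finset.Ico (b * h) ((b + 1) * h) → i < m * h := by
    intro b hb i hi
    exact (Finset.mem_Ico.mp hi).2.trans_le (Nat.mul_le_mul_right h hb)
  refine ⟨fun b hb a ha => ?_, fun b hb => ?_, fun b hb c hc hadj => ?_⟩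
  · obtain ⟨i, hi, rfl⟩ := Finset.mem_image.mp ha
    exact Finset.mem_range.mpr (hk i (hlt b hb i hi))
  · unfold blockColors
    rw [Finset.card_image_of_injOn, Nat.card_Ico, add_mul, one_mul, Nat.add_sub_cancel_left]
    intro i hi j hj he
    by_contra hne
    refine hp i j (hlt b hb i hi) (hlt b hb j hj) ⟨hne, Or.inl ?_⟩ he
    dsimp only
    rw [hdiv b i hi, hdiv b j hj]
  · rw [Finset.disjoint_left]
    intro a ha ha'
    obtain ⟨i, hi, rfl⟩ := Finset.mem_image.mp ha
    obtain ⟨j, hj, he⟩ := Finset.mem_image.mp ha'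
    have hadj' : G.Adj (f (i / h)) (f (j / h)) := by rwa [hdiv b i hi, hdiv c j hj]
    refine hp i j (hlt b hb i hi) (hlt c hc j hj) ⟨?_, Or.inr hadj'⟩ he.symm
    rintro rfl
    exact G.irrefl hadj'

lemma colorOf_getLast_count {V : Type*} [DecidableEq V] (g : V → ℕ) (s : ℕ → V) (i k : ℕ) :
    colorOf (fun l => match l.getLast? with
      | none => 0
      | some v => g v * k + (l.dropLast.count v)) s i =
      g (s i) * k + ((Finset.range i).filter fun j => s j = s i).card := by
  have hl : (List.ofFn fun j : Fin (i + 1) => s j) = (List.range i).map s ++ [s i] := by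
    rw [List.ofFn_succ_last]
    simp only [Fin.val_castSucc, Fin.val_last]
    congr 1
    refine List.ext_getElem (by simp) fun a h1 h2 => ?_
    simp
  unfold colorOf
  rw [hl]
  simp only [List.getLast?_append, List.getLast?_singleton, Option.some_or, List.dropLast_concat]
  congr 1
  rw [List.count, List.countP_map, List.countP_eq_length_filter, Finset.card_def]
  simp only [Finset.filter_val, Finset.range_val, Multiset.range, Multiset.filter_coe,
    Multiset.coe_card]
  congr 2

/-- On a finite graph, Algorithm can win by reserving `w` colors for each vertex. -/
lemma exists_algWins {V : Type*} [Fintype V] (G : SimpleGraph V) (w : ℕ) :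
    ∃ k, ∃ σ : List V → ℕ, AlgWins G w k σ := by
  classical
  let g : V → ℕ := fun v => Fintype.equivFin V v
  have hg : ∀ v, g v < Fintype.card V := fun v => Fin.is_lt _
  have hginj : Function.Injective g := fun a b hab =>
    (Fintype.equivFin V).injective (Fin.ext hab)
  refine ⟨Fintype.card V * w, fun l => match l.getLast? with
      | none => 0
      | some v => g v * w + (l.dropLast.count v), fun n s ⟨φ, hφ, hφp⟩ => ?_⟩
  have hcount : ∀ i < n, ((Finset.range i).filter fun j => s j = s i).card < w := by
    intro i hi
    have hsub : ((Finset.range (i + 1)).filter fun j => s j = s i).image φ ⊆ Finset.range w := by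
      intro a ha
      obtain ⟨j, hj, rfl⟩ := Finset.mem_image.mp ha
      simp only [Finset.mem_filter, Finset.mem_range] at hj ⊢
      exact hφ j (by omega)
    have hcard := Finset.card_le_card hsub
    rw [Finset.card_image_of_injOn, Finset.card_range, Finset.range_add_one,
      Finset.filter_insert, if_pos rfl, Finset.card_insert_of_notMem (by simp)] at hcard
    · exact hcard
    · intro a ha b hb he
      simp only [Finset.coe_filter, Finset.mem_range, Set.mem_ofPred_eq] at ha hb
      by_contra hne
      exact hφp a b (by omega) (by omega) ⟨hne, Or.inl (ha.2.trans hb.2.symm)⟩ he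
  simp only [colorOf_getLast_count]
  refine ⟨fun i hi => ?_, ?_⟩
  · have := hcount i hi
    have := hg (s i)
    nlinarith
  · intro i j hi hj hij he
    have ci := hcount i hi
    have cj := hcount j hj
    have hw : 0 < w := by omega
    have hgs : g (s i) = g (s j) := by
      have := congrArg (· / w) he
      simpa only [mul_comm _ w, Nat.mul_add_div hw, Nat.div_eq_of_lt ci, Nat.div_eq_of_lt cj,
        add_zero] using this
    have hs := hginj hgs
    rw [hgs, hs, add_right_inj] at he
    rcases lt_or_gt_of_ne hij.1 with hlt | hlt
    · refine absurd he (ne_of_lt (Finset.card_lt_card ?_))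
      rw [Finset.ssubset_iff_of_subset]
      · exact ⟨i, by simp [hlt, hs], by simp⟩
      · intro a ha
        simp only [Finset.mem_filter, Finset.mem_range] at ha ⊢
        exact ⟨ha.1.trans hlt, ha.2⟩
    · refine absurd he.symm (ne_of_lt (Finset.card_lt_card ?_))
      rw [Finset.ssubset_iff_of_subset]
      · exact ⟨j, by simp [hlt], by simp⟩
      · intro a ha
        simp only [Finset.mem_filter, Finset.mem_range] at ha ⊢
        exact ⟨ha.1.trans hlt, ha.2⟩

lemma card_sdiff_add_le_of_disjoint {A B Z : Finset ℕ} {h k : ℕ} (hA : A ⊆ Finset.range k)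
    (hB : B ⊆ Finset.range k) (hZ : Z ⊆ Finset.range k) (cB : B.card = h) (cZ : Z.card = h)
    (hAZ : Disjoint A Z) (hBZ : Disjoint B Z) : (A \ B).card + 2 * h ≤ k := by
  have hd : Disjoint (A \ B) B := Finset.sdiff_disjoint
  have hd' : Disjoint (A \ B ∪ B) Z :=
    Finset.disjoint_union_left.mpr ⟨hAZ.mono_left Finset.sdiff_subset, hBZ⟩
  have hsub : A \ B ∪ B ∪ Z ⊆ Finset.range k :=
    Finset.union_subset (Finset.union_subset (Finset.sdiff_subset.trans hA) hB) hZ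
  have := Finset.card_le_card hsub
  rw [Finset.card_union_of_disjoint hd', Finset.card_union_of_disjoint hd, Finset.card_range]
    at this
  omega

lemma card_sdiff_le_mul {A : ℕ → Finset ℕ} {t e : ℕ}
    (hA : ∀ i, i + 1 < t → (A i \ A (i + 1)).card ≤ e) :
    ∀ j < t, (A 0 \ A j).card ≤ j * e := by
  intro j
  induction j with
  | zero => simp
  | succ j ih =>
    intro hj
    have hsub : A 0 \ A (j + 1) ⊆ (A 0 \ A j) ∪ (A j \ A (j + 1)) := by
      intro a ha
      simp only [Finset.mem_union, Finset.mem_sdiff] at ha ⊢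
      tauto
    have h1 := (Finset.card_le_card hsub).trans (Finset.card_union_le _ _)
    have h2 := ih (by omega)
    have h3 := hA j hj
    rw [add_mul, one_mul]
    omega

/-- The position of `u i` in the order `u 0, u (t - 1), u 1, u 2, …, u (t - 2)`. -/
def endsFirstPos (t i : ℕ) : ℕ := if i = 0 then 0 else if i = t - 1 then 1 else i + 1

/-- The sequence `u 0, u (t - 1), u 1, u 2, …, u (t - 2), z, z, …`. -/
def endsFirst {V : Type*} {t : ℕ} (ht : 0 < t) (u : Fin t → V) (z : V) (b : ℕ) : V :=
  if b = 0 then u ⟨0, ht⟩ else if b = 1 then u ⟨t - 1, Nat.sub_lt ht Nat.one_pos⟩ else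
    if hb : b < t then u ⟨b - 1, by omega⟩ else z

lemma endsFirstPos_lt {t : ℕ} (ht : 2 ≤ t) {i : ℕ} (hi : i < t) : endsFirstPos t i < t := by
  unfold endsFirstPos
  split_ifs <;> omega

lemma endsFirst_endsFirstPos {V : Type*} {t : ℕ} (ht : 2 ≤ t) (u : Fin t → V) (z : V)
    (i : Fin t) : endsFirst (by omega) u z (endsFirstPos t i) = u i := by
  have := i.2
  by_cases h0 : (i : ℕ) = 0
  · simp only [endsFirstPos, endsFirst, h0, if_true]
    exact congrArg u (Fin.ext h0.symm)
  by_cases h1 : (i : ℕ) = t - 1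
  · simp only [endsFirstPos, endsFirst, h0, if_false, ← h1, if_true, one_ne_zero]
  · have h2 : (i : ℕ) + 1 < t := by omega
    simp [endsFirstPos, endsFirst, h0, h1, h2]

lemma endsFirst_injOn {V : Type*} {t : ℕ} (ht : 2 ≤ t) {u : Fin t → V}
    (hu : Function.Injective u) (z : V) {b c : ℕ} (hb : b < t) (hc : c < t)
    (he : endsFirst (by omega) u z b = endsFirst (by omega) u z c) : b = c := by
  unfold endsFirst at he
  split_ifs at he <;> first | omega | (have := Fin.ext_iff.mp (hu he); dsimp only at this; omega)

lemma endsFirst_mem_range {V : Type*} {t : ℕ} (ht : 0 < t) (u : Fin t → V) (z : V) {b : ℕ}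
    (hb : b < t) : endsFirst ht u z b ∈ Set.range u := by
  unfold endsFirst
  split_ifs <;> exact Set.mem_range_self _

lemma endsFirst_self {V : Type*} {t : ℕ} (ht : 2 ≤ t) (u : Fin t → V) (z : V) :
    endsFirst (by omega) u z t = z := by
  unfold endsFirst
  split_ifs <;> first | omega | rfl

lemma endsFirst_congr {V : Type*} {t : ℕ} (ht : 0 < t) (u : Fin t → V) (z z' : V) {b : ℕ}
    (hb : b < t) : endsFirst ht u z b = endsFirst ht u z' b := by
  unfold endsFirst
  split_ifs <;> rfl

lemma lower_bound_arith {t h k d : ℕ} (ht : 0 < t) (hk : 2 * h ≤ k) (hd : 3 * h ≤ d + k)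
    (hdk : d ≤ (t - 1) * (k - 2 * h)) :
    (1 + 1 / (2 * (t : ℚ))) * ((2 * h : ℕ) : ℚ) ≤ (k : ℚ) := by
  obtain ⟨e, rfl⟩ : ∃ e, k = 2 * h + e := Nat.exists_eq_add_of_le hk
  obtain ⟨r, rfl⟩ : ∃ r, t = r + 1 := ⟨t - 1, by omega⟩
  simp only [Nat.add_sub_cancel_left, Nat.add_sub_cancel] at hdk
  have hfin : h ≤ (r + 1) * e := by
    rw [add_mul, one_mul]
    omega
  have hfinQ : (h : ℚ) ≤ ((r + 1 : ℕ) : ℚ) * e := by exact_mod_cast hfin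
  have htQ : (0 : ℚ) < ((r + 1 : ℕ) : ℚ) := by positivity
  have hle : (h : ℚ) / ((r + 1 : ℕ) : ℚ) ≤ e := by
    rw [div_le_iff₀ htQ, mul_comm]
    exact hfinQ
  have heq : (1 + 1 / (2 * ((r + 1 : ℕ) : ℚ))) * ((2 * h : ℕ) : ℚ) =
      2 * h + (h : ℚ) / ((r + 1 : ℕ) : ℚ) := by
    push_cast
    field_simp
  rw [heq]
  push_cast at hle ⊢
  linarith

/-- Spoiler's strategy (lower bound). Let `u 0, …, u (t-1)` be distinct vertices of a
finite graph `G` such that: (i) there are vertices `x, y` with `u 0, x, y, u (t-1)` a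
path in `G` whose four vertices induce a bipartite subgraph; and (ii) for each `i` with
`i + 1 < t` there is a common neighbor `z` of `u i` and `u (i+1)` such that the vertices
`u 0, …, u (t-1), z` induce a bipartite subgraph.  Then for every even positive integer
`w`, `f(w, G) ≥ (1 + 1/(2t)) · w`. -/
theorem gameValue_lower_of_spoiler_strategy {V : Type} [Fintype V] (G : SimpleGraph V)
    (t : ℕ) (ht : 0 < t) (u : Fin t → V) (hu : Function.Injective u) (x y : V)
    (h1 : G.Adj (u ⟨0, ht⟩) x) (h2 : G.Adj x y)
    (h3 : G.Adj y (u ⟨t - 1, Nat.sub_lt ht Nat.one_pos⟩))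
    (hnd : List.Nodup [u ⟨0, ht⟩, x, y, u ⟨t - 1, Nat.sub_lt ht Nat.one_pos⟩])
    (hbip : (G.induce
        {v | v = u ⟨0, ht⟩ ∨ v = x ∨ v = y ∨
          v = u ⟨t - 1, Nat.sub_lt ht Nat.one_pos⟩}).Colorable 2)
    (hz : ∀ i : ℕ, ∀ h : i + 1 < t, ∃ z : V,
        G.Adj (u ⟨i, Nat.lt_of_succ_lt h⟩) z ∧ G.Adj z (u ⟨i + 1, h⟩) ∧
          (G.induce (Set.range u ∪ {z})).Colorable 2)
    (w : ℕ) (hw : 0 < w) (hweven : Even w) :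
    (1 + 1 / (2 * (t : ℚ))) * w ≤ (gameValue G w : ℚ) := by
  obtain ⟨h, rfl⟩ := hweven
  rw [← two_mul] at *
  have hh : 0 < h := by omega
  have ht2 : 2 ≤ t := by
    by_contra hlt
    have : t = 1 := by omega
    subst this
    simp at hnd
  obtain ⟨σ, hσ⟩ := Nat.sInf_mem (exists_algWins G (2 * h))
  change AlgWins G (2 * h) (gameValue G (2 * h)) σ at hσ
  generalize gameValue G (2 * h) = k at hσ ⊢
  set A : ℕ → Finset ℕ := fun i => blockColors σ h (endsFirst ht u x) (endsFirstPos t i) with hA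
  have hAz : ∀ z, ∀ i < t,
      A i = blockColors σ h (endsFirst ht u z) (endsFirstPos t i) := fun z i hi =>
    blockColors_congr σ h fun c hc =>
      endsFirst_congr ht u x z (hc.trans_lt (endsFirstPos_lt ht2 hi))
  have hstep : ∀ i, i + 1 < t → (A i \ A (i + 1)).card ≤ k - 2 * h := by
    intro i hi
    obtain ⟨z, hz1, hz2, hzS⟩ := hz i hi
    have hi' : i < t := by omega
    have hp : ∀ j (hj : j < t), endsFirst ht u z (endsFirstPos t j) = u ⟨j, hj⟩ :=
      fun j hj => endsFirst_endsFirstPos ht2 u z ⟨j, hj⟩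
    have hlt : ∀ j < t, endsFirstPos t j < t := fun j hj => endsFirstPos_lt ht2 hj
    obtain ⟨m, b, htm, hbm, hbz, hmem, hinj⟩ : ∃ m b, t ≤ m ∧ b < m ∧ endsFirst ht u z b = z ∧
        (∀ c < m, endsFirst ht u z c ∈ Set.range u ∪ {z}) ∧
        ∀ c < m, ∀ d < m, endsFirst ht u z c = endsFirst ht u z d → c = d := by
      by_cases hzu : z ∈ Set.range u
      · obtain ⟨j, hj⟩ := hzu
        exact ⟨t, endsFirstPos t j, le_rfl, hlt j j.2, (hp j j.2).trans hj,
          fun c hc => Or.inl (endsFirst_mem_range ht u z hc),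
          fun c hc d hd => endsFirst_injOn ht2 hu z hc hd⟩
      · refine ⟨t + 1, t, Nat.le_succ t, Nat.lt_succ_self t, endsFirst_self ht2 u z, ?_, ?_⟩
        · intro c hc
          rcases Nat.lt_succ_iff_lt_or_eq.mp hc with hc | rfl
          · exact Or.inl (endsFirst_mem_range ht u z hc)
          · exact Or.inr (endsFirst_self ht2 u z)
        · intro c hc d hd he
          rcases Nat.lt_succ_iff_lt_or_eq.mp hc with hc | hc <;>
            rcases Nat.lt_succ_iff_lt_or_eq.mp hd with hd | hd
          · exact endsFirst_injOn ht2 hu z hc hd he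
          · rw [hd, endsFirst_self ht2 u z] at he
            exact absurd (he ▸ endsFirst_mem_range ht u z hc) hzu
          · rw [hc, endsFirst_self ht2 u z] at he
            exact absurd (he ▸ endsFirst_mem_range ht u z hd) hzu
          · rw [hc, hd]
    obtain ⟨hk, hc, hd⟩ := hσ.blockColors_spec hh hzS hmem hinj
    have l1 := (hlt i hi').trans_le htm
    have l2 := (hlt (i + 1) hi).trans_le htm
    rw [hAz z i hi', hAz z (i + 1) hi]
    refine Nat.le_sub_of_add_le (card_sdiff_add_le_of_disjoint (hk _ l1) (hk _ l2) (hk _ hbm)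
      (hc _ l2) (hc _ hbm) (hd _ l1 _ hbm ?_) (hd _ l2 _ hbm ?_))
    · rwa [hp i hi', hbz]
    · rw [hp (i + 1) hi, hbz]
      exact hz2.symm
  have hends := card_sdiff_le_mul hstep (t - 1) (by omega)
  let f : ℕ → V := fun b => if b = 0 then u ⟨0, ht⟩ else
    if b = 1 then u ⟨t - 1, Nat.sub_lt ht Nat.one_pos⟩ else if b = 2 then x else y
  simp only [List.nodup_cons, List.mem_cons, List.not_mem_nil, or_false, not_or] at hnd
  obtain ⟨⟨n1, n2, n3⟩, ⟨n4, n5⟩, n6, -⟩ := hnd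
  obtain ⟨hk, hc, hd⟩ := hσ.blockColors_spec (m := 4) (f := f) hh hbip
    (fun b _ => by
      simp only [f, Set.mem_ofPred_eq]
      split_ifs <;> simp)
    (fun b hb c hc he => by
      interval_cases b <;> interval_cases c <;> simp_all [f, eq_comm])
  have hA0 : A 0 = blockColors σ h f 0 := by
    refine blockColors_congr σ h fun c hc => ?_
    obtain rfl : c = 0 := Nat.le_zero.mp hc
    simp [f, endsFirst]
  have hA1 : A (t - 1) = blockColors σ h f 1 := by
    have hpos : endsFirstPos t (t - 1) = 1 := by
      unfold endsFirstPos
      split_ifs <;> omega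
    simp only [hA, hpos]
    refine blockColors_congr σ h fun c hc => ?_
    interval_cases c <;> simp [f, endsFirst]
  have d02 := hd 0 (by norm_num) 2 (by norm_num) (by simpa [f] using h1)
  have d23 := hd 2 (by norm_num) 3 (by norm_num) (by simpa [f] using h2)
  have d13 := hd 1 (by norm_num) 3 (by norm_num) (by simpa [f] using h3.symm)
  have c0 := hc 0 (by norm_num)
  have c2 := hc 2 (by norm_num)
  have c3 := hc 3 (by norm_num)
  rw [hA0, hA1] at hends
  have hX := card_sdiff_add_le_of_disjoint (hk 3 (by norm_num)) (hk 0 (by norm_num))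
    (hk 2 (by norm_num)) c0 c2 d23.symm d02
  have hY : h ≤ (blockColors σ h f 3 \ blockColors σ h f 0).card +
      (blockColors σ h f 0 \ blockColors σ h f 1).card := by
    refine c3.symm.le.trans ((Finset.card_le_card fun a ha => ?_).trans (Finset.card_union_le _ _))
    have ha1 := Finset.disjoint_right.mp d13 ha
    by_cases ha0 : a ∈ blockColors σ h f 0
    · exact Finset.mem_union_right _ (Finset.mem_sdiff.mpr ⟨ha0, ha1⟩)
    · exact Finset.mem_union_left _ (Finset.mem_sdiff.mpr ⟨ha, ha0⟩)
  exact lower_bound_arith ht (by omega) (by omega) hends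
end
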